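/- For $\alpha,\beta\ge 0$ with $\alpha+\beta>0$ and a continuous function $f:\mathbb R\to\mathbb R$, define the snapping-out extensions of $f$ by $$E_\ell^{\mathrm{so}}[\alpha,\beta]f(x)=\begin{cases} f(x), & x\le 0,\\ f(-x)+2\alpha\int_0^x e^{-(\alpha+\beta)(x-y)}\,(f(y)-f(-y))\,dy, & x>0,\end{cases}$$ $$E_r^{\mathrm{so}}[\alpha,\beta]f(x)=\begin{cases} f(x), & x\ge 0,\\ f(-x)-2\beta\int_0^{-x} e^{-(\alpha+\beta)(-x-y)}\,(f(y)-f(-y))\,dy, & x<0,\end{cases}$$ and the skew extensions of $f$ by $$E_\ell^{\mathrm{skew}}[\alpha,\beta]f(x)=\begin{cases} f(x), & x\le 0,\\ \frac{\beta-\alpha}{\alpha+\beta}f(-x)+\frac{2\alpha}{\alpha+\beta}f(x), & x>0,\end{cases}\qquad E_r^{\mathrm{skew}}[\alpha,\beta]f(x)=\begin{cases} f(x), & x\ge 0,\\ \frac{2\beta}{\alpha+\beta}f(x)+\frac{\alpha-\beta}{\alpha+\beta}f(-x), & x<0.\end{cases}$$ For $\bullet\in\{\mathrm{so},\mathrm{skew}\}$,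 $t\in\mathbb R$ and $x\ne 0$, the corresponding cosine family is $$C^{\bullet}[\alpha,\beta](t)f(x)=\begin{cases}\tfrac12\big(E_\ell^{\bullet}[\alpha,\beta]f(x+t)+E_\ell^{\bullet}[\alpha,\beta]f(x-t)\big), & x<0,\\ \tfrac12\big(E_r^{\bullet}[\alpha,\beta]f(x+t)+E_r^{\bullet}[\alpha,\beta]f(x-t)\big), & x>0.\end{cases}$$ Let $\alpha,\beta\ge 0$ with $\alpha+\beta>0$, let $L\ge 0$, and let $f:\mathbb R\to\mathbb R$ be bounded and $L$-Lipschitz, that is, $|f(x)-f(y)|\le L|x-y|$ for all $x,y\in\mathbb R$. Then for every positive integer $n$: (i) $\displaystyle |E_\ell^{\mathrm{so}}[n\alpha,n\beta]f(x)-E_\ell^{\mathrm{skew}}[\alpha,\beta]f(x)|\le \frac{4\alpha L}{n(\alpha+\beta)^2}$ for every $x\in\mathbb R$; (ii) $\displaystyle |E_r^{\mathrm{so}}[n\alpha,n\beta]f(x)-E_r^{\mathrm{skew}}[\alpha,\beta]f(x)|\le \frac{4\beta L}{n(\alpha+\beta)^2}$ for every $x\in\mathbb R$; (iii) $\displaystyle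 |C^{\mathrm{so}}[n\alpha,n\beta](t)f(x)-C^{\mathrm{skew}}[\alpha,\beta](t)f(x)|\le \frac{2\max(\alpha,\beta)L}{n(\alpha+\beta)^2}$ for every $t\in\mathbb R$ and every $x\ne 0$. -/

import Mathlib

/-- Left snapping-out extension `Eℓ^so[α,β]f`. -/
noncomputable def Elso (α β : ℝ) (f : ℝ → ℝ) (x : ℝ) : ℝ :=
  if x ≤ 0 then f x
  else f (-x) + 2 * α * ∫ y in (0 : ℝ)..x, Real.exp (-(α + β) * (x - y)) * (f y - f (-y))

/-- Right snapping-out extension `Er^so[α,β]f`. -/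
noncomputable def Erso (α β : ℝ) (f : ℝ → ℝ) (x : ℝ) : ℝ :=
  if 0 ≤ x then f x
  else f (-x) - 2 * β * ∫ y in (0 : ℝ)..(-x), Real.exp (-(α + β) * (-x - y)) * (f y - f (-y))

/-- Left skew extension `Eℓ^skew[α,β]f`. -/
noncomputable def Elskew (α β : ℝ) (f : ℝ → ℝ) (x : ℝ) : ℝ :=
  if x ≤ 0 then f x
  else ((β - α) / (α + β)) * f (-x) + (2 * α / (α + β)) * f x

/-- Right skew extension `Er^skew[α,β]f`. -/
noncomputable def Erskew (α β : ℝ) (f : ℝ → ℝ) (x : ℝ) : ℝ :=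
  if 0 ≤ x then f x
  else (2 * β / (α + β)) * f x + ((α - β) / (α + β)) * f (-x)

/-- Snapping-out cosine family `C^so[α,β](t)f(x)` (for `x ≠ 0`). -/
noncomputable def Cso (α β : ℝ) (f : ℝ → ℝ) (t x : ℝ) : ℝ :=
  if x < 0 then (1 / 2) * (Elso α β f (x + t) + Elso α β f (x - t))
  else (1 / 2) * (Erso α β f (x + t) + Erso α β f (x - t))

/-- Skew cosine family `C^skew[α,β](t)f(x)` (for `x ≠ 0`). -/
noncomputable def Cskew (α β : ℝ) (f : ℝ → ℝ) (t x : ℝ) : ℝ :=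
  if x < 0 then (1 / 2) * (Elskew α β f (x + t) + Elskew α β f (x - t))
  else (1 / 2) * (Erskew α β f (x + t) + Erskew α β f (x - t))

open intervalIntegral in
/-- The exponential kernel of rate `c` integrates to `(1 - e^{-cx}) / c` over `[0, x]`. -/
theorem integral_exp_kernel {c : ℝ} (hc : c ≠ 0) (x : ℝ) :
    ∫ y in (0 : ℝ)..x, Real.exp (-c * (x - y)) = (1 - Real.exp (-c * x)) / c := by
  have hderiv : ∀ y ∈ Set.uIcc 0 x, HasDerivAt (fun y => Real.exp (-c * (x - y)) / c)
      (Real.exp (-c * (x - y))) y := by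
    intro y _
    have h := ((((hasDerivAt_id y).const_sub x).const_mul (-c)).exp).div_const c
    refine h.congr_deriv ?_
    simp only [id]
    field_simp
  rw [integral_eq_sub_of_hasDerivAt hderiv
    (Continuous.intervalIntegrable (by fun_prop) _ _)]
  simp [sub_div]

open intervalIntegral in
/-- First moment of the exponential kernel of rate `c` over `[0, x]`. -/
theorem integral_exp_kernel_mul_sub {c : ℝ} (hc : c ≠ 0) (x : ℝ) :
    ∫ y in (0 : ℝ)..x, Real.exp (-c * (x - y)) * (x - y)
      = 1 / c ^ 2 - Real.exp (-c * x) * (x / c + 1 / c ^ 2) := by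
  have hderiv : ∀ y ∈ Set.uIcc 0 x,
      HasDerivAt (fun y => Real.exp (-c * (x - y)) * ((x - y) / c + 1 / c ^ 2))
      (Real.exp (-c * (x - y)) * (x - y)) y := by
    intro y _
    have hs := (hasDerivAt_id y).const_sub x
    have h := (hs.const_mul (-c)).exp.mul ((hs.div_const c).add_const (1 / c ^ 2))
    refine h.congr_deriv ?_
    simp only [id]
    field_simp
    ring
  rw [integral_eq_sub_of_hasDerivAt hderiv
    (Continuous.intervalIntegrable (by fun_prop) _ _)]
  simp

/-- Smoothing a `K`-Lipschitz function vanishing at `0` by the exponential kernel of rate `c`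
changes it by at most `K / c`, up to the normalisation `1 / c` of the kernel. -/
theorem abs_integral_exp_kernel_mul_sub_div_le {c K : ℝ} (hc : 0 < c) (hK : 0 ≤ K) {g : ℝ → ℝ}
    (hg : ∀ x y, |g x - g y| ≤ K * |x - y|) (hg0 : g 0 = 0) {x : ℝ} (hx : 0 ≤ x) :
    |(∫ y in (0 : ℝ)..x, Real.exp (-c * (x - y)) * g y) - g x / c| ≤ K / c ^ 2 := by
  have hgc : Continuous g :=
    (LipschitzWith.of_dist_le_mul (K := ⟨K, hK⟩) fun x y => hg x y).continuous
  have hsplit : (∫ y in (0 : ℝ)..x, Real.exp (-c * (x - y)) * g y) - g x / c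
      = (∫ y in (0 : ℝ)..x, Real.exp (-c * (x - y)) * (g y - g x))
        - g x * (Real.exp (-c * x) / c) := by
    simp only [mul_sub (Real.exp _)]
    rw [intervalIntegral.integral_sub (Continuous.intervalIntegrable (by fun_prop) _ _)
      (Continuous.intervalIntegrable (by fun_prop) _ _),
      intervalIntegral.integral_mul_const, integral_exp_kernel hc.ne']
    ring
  have hint : |∫ y in (0 : ℝ)..x, Real.exp (-c * (x - y)) * (g y - g x)|
      ≤ K * (1 / c ^ 2 - Real.exp (-c * x) * (x / c + 1 / c ^ 2)) := by
    rw [← integral_exp_kernel_mul_sub hc.ne', ← intervalIntegral.integral_const_mul]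
    refine (intervalIntegral.abs_integral_le_integral_abs hx).trans
      (intervalIntegral.integral_mono_on hx (Continuous.intervalIntegrable (by fun_prop) _ _)
        (Continuous.intervalIntegrable (by fun_prop) _ _) fun y hy => ?_)
    have h := hg y x
    rw [abs_sub_comm y x, abs_of_nonneg (sub_nonneg.2 hy.2)] at h
    rw [abs_mul, Real.abs_exp]
    calc Real.exp (-c * (x - y)) * |g y - g x|
        ≤ Real.exp (-c * (x - y)) * (K * (x - y)) := by gcongr
      _ = K * (Real.exp (-c * (x - y)) * (x - y)) := by ring
  have hbd : |g x * (Real.exp (-c * x) / c)| ≤ K * x * (Real.exp (-c * x) / c) := by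
    have h := hg x 0
    rw [hg0, sub_zero, sub_zero, abs_of_nonneg hx] at h
    have hpos : 0 ≤ Real.exp (-c * x) / c := by positivity
    rw [abs_mul, abs_of_nonneg hpos]
    gcongr
  have hrest : 0 ≤ K * Real.exp (-c * x) / c ^ 2 := by positivity
  rw [hsplit]
  refine (abs_sub _ _).trans ((add_le_add hint hbd).trans ?_)
  calc K * (1 / c ^ 2 - Real.exp (-c * x) * (x / c + 1 / c ^ 2))
        + K * x * (Real.exp (-c * x) / c)
      = K / c ^ 2 - K * Real.exp (-c * x) / c ^ 2 := by ring
    _ ≤ K / c ^ 2 := by linarith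

/-- The odd difference `y ↦ f y - f (-y)` of an `L`-Lipschitz function, smoothed by the
exponential kernel of rate `n s` and weighted by `2 n a`. -/
theorem abs_weighted_integral_odd_difference_le {a s L : ℝ} (ha : 0 ≤ a) (hs : 0 < s)
    (hL : 0 ≤ L) {f : ℝ → ℝ} (hlip : ∀ x y, |f x - f y| ≤ L * |x - y|) {n : ℝ} (hn : 0 < n)
    {x : ℝ} (hx : 0 ≤ x) :
    |2 * (n * a) * (∫ y in (0 : ℝ)..x, Real.exp (-(n * s) * (x - y)) * (f y - f (-y)))
      - 2 * a / s * (f x - f (-x))| ≤ 4 * a * L / (n * s ^ 2) := by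
  have hg : ∀ x y, |(f x - f (-x)) - (f y - f (-y))| ≤ 2 * L * |x - y| := by
    intro x y
    have h₁ := hlip x y
    have h₂ := hlip (-y) (-x)
    rw [show -y - -x = x - y by ring] at h₂
    calc |(f x - f (-x)) - (f y - f (-y))| = |(f x - f y) + (f (-y) - f (-x))| := by
          congr 1; ring
      _ ≤ |f x - f y| + |f (-y) - f (-x)| := abs_add_le _ _
      _ ≤ 2 * L * |x - y| := by linarith
  have key := abs_integral_exp_kernel_mul_sub_div_le (mul_pos hn hs)
    (mul_nonneg zero_le_two hL) (g := fun y => f y - f (-y)) hg (by simp) hx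
  set I := ∫ y in (0 : ℝ)..x, Real.exp (-(n * s) * (x - y)) * (f y - f (-y))
  have hw : 0 ≤ 2 * (n * a) := by positivity
  calc |2 * (n * a) * I - 2 * a / s * (f x - f (-x))|
      = |2 * (n * a) * (I - (f x - f (-x)) / (n * s))| := by
        congr 1; field_simp
    _ = 2 * (n * a) * |I - (f x - f (-x)) / (n * s)| := by
        rw [abs_mul, abs_of_nonneg hw]
    _ ≤ 2 * (n * a) * (2 * L / (n * s) ^ 2) := by gcongr
    _ = 4 * a * L / (n * s ^ 2) := by field_simp; ring

theorem abs_Elso_sub_Elskew_le {α β L : ℝ} (hα : 0 ≤ α) (hαβ : 0 < α + β) (hL : 0 ≤ L)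
    {f : ℝ → ℝ} (hlip : ∀ x y, |f x - f y| ≤ L * |x - y|) {n : ℝ} (hn : 0 < n) (x : ℝ) :
    |Elso (n * α) (n * β) f x - Elskew α β f x| ≤ 4 * α * L / (n * (α + β) ^ 2) := by
  unfold Elso Elskew
  split_ifs with hx
  · rw [sub_self, abs_zero]; positivity
  · convert abs_weighted_integral_odd_difference_le hα hαβ hL hlip hn (not_le.1 hx).le using 2
    rw [← mul_add]
    field_simp
    ring

theorem abs_Erso_sub_Erskew_le {α β L : ℝ} (hβ : 0 ≤ β) (hαβ : 0 < α + β) (hL : 0 ≤ L)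
    {f : ℝ → ℝ} (hlip : ∀ x y, |f x - f y| ≤ L * |x - y|) {n : ℝ} (hn : 0 < n) (x : ℝ) :
    |Erso (n * α) (n * β) f x - Erskew α β f x| ≤ 4 * β * L / (n * (α + β) ^ 2) := by
  unfold Erso Erskew
  split_ifs with hx
  · rw [sub_self, abs_zero]; positivity
  · rw [abs_sub_comm]
    convert abs_weighted_integral_odd_difference_le hβ hαβ hL hlip hn
      (neg_pos.2 (not_le.1 hx)).le using 2
    rw [← mul_add, neg_neg]
    field_simp
    ring

/-- If two functions agree at one of two points and are `B`-close at both, then their averages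
over the two points are `B / 2`-close. -/
theorem abs_half_add_sub_half_add_le {a b a' b' B : ℝ} (ha : |a - a'| ≤ B) (hb : |b - b'| ≤ B)
    (h : a = a' ∨ b = b') : |1 / 2 * (a + b) - 1 / 2 * (a' + b')| ≤ B / 2 := by
  rw [abs_le] at *
  rcases h with rfl | rfl <;> constructor <;> linarith

theorem snappingOut_skew_lipschitz_rate
    (α β : ℝ) (hα : 0 ≤ α) (hβ : 0 ≤ β) (hαβ : 0 < α + β)
    (L : ℝ) (hL : 0 ≤ L) (f : ℝ → ℝ)
    (hbdd : ∃ M : ℝ, ∀ x : ℝ, |f x| ≤ M)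
    (hlip : ∀ x y : ℝ, |f x - f y| ≤ L * |x - y|) :
    ∀ n : ℕ, 0 < n →
      (∀ x : ℝ,
        |Elso ((n : ℝ) * α) ((n : ℝ) * β) f x - Elskew α β f x|
          ≤ 4 * α * L / ((n : ℝ) * (α + β) ^ 2)) ∧
      (∀ x : ℝ,
        |Erso ((n : ℝ) * α) ((n : ℝ) * β) f x - Erskew α β f x|
          ≤ 4 * β * L / ((n : ℝ) * (α + β) ^ 2)) ∧
      (∀ t x : ℝ, x ≠ 0 →
        |Cso ((n : ℝ) * α) ((n : ℝ) * β) f t x - Cskew α β f t x|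
          ≤ 2 * max α β * L / ((n : ℝ) * (α + β) ^ 2)) := by
  intro n hn
  have hn : (0 : ℝ) < n := Nat.cast_pos.2 hn
  have hl := abs_Elso_sub_Elskew_le hα hαβ hL hlip hn
  have hr := abs_Erso_sub_Erskew_le hβ hαβ hL hlip hn
  refine ⟨hl, hr, fun t x hx => ?_⟩
  unfold Cso Cskew
  split_ifs with hx0
  · have hagree : ∀ y ≤ 0, Elso (n * α) (n * β) f y = Elskew α β f y := fun y hy => by
      simp [Elso, Elskew, hy]
    refine (abs_half_add_sub_half_add_le (hl _) (hl _) ?_).trans ?_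
    · rcases le_total t 0 with ht | ht
      · exact Or.inl (hagree _ (by linarith))
      · exact Or.inr (hagree _ (by linarith))
    · rw [show 4 * α * L / (n * (α + β) ^ 2) / 2 = 2 * α * L / (n * (α + β) ^ 2) by ring]
      gcongr
      exact le_max_left _ _
  · have hagree : ∀ y, 0 ≤ y → Erso (n * α) (n * β) f y = Erskew α β f y := fun y hy => by
      simp [Erso, Erskew, hy]
    refine (abs_half_add_sub_half_add_le (hr _) (hr _) ?_).trans ?_
    · rcases le_total 0 t with ht | ht
      · exact Or.inl (hagree _ (by linarith))
      · exact Or.inr (hagree _ (by linarith))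
    · rw [show 4 * β * L / (n * (α + β) ^ 2) / 2 = 2 * β * L / (n * (α + β) ^ 2) by ring]
      gcongr
      exact le_max_right _ _
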